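/- Let X be a real Banach space, K₁ ⊂ X a compact set, K₂ ⊂ ℝ^d a compact set, U a compact subset of C(K₁), and F : U → C(K₂) a continuous (possibly nonlinear) operator. Let ϕ^{tr} : ℝ → ℝ and ϕ^{br} : ℝ → ℝ be Lipschitz continuous functions bounded in absolute value by 1. Suppose that p^{tr} is a probability measure on ℝ^d that is (ϕ^{tr}, K₂)-rich, and that for every m ∈ ℕ there is a probability measure p^{br}_m on ℝ^m that is (ϕ^{br}, V)-rich for every compact set V ⊂ ℝ^m. Then for every ε > 0 and every δ ∈ (0,1) there exist N, M, m ∈ ℕ and points x_1, …, x_m ∈ K₁ such that there is a measurable set E ⊆ (ℝ^d)^N × (ℝ^m)^M with (p^{tr})^{⊗N} ⊗ (p^{br}_m)^{⊗M}(E) ≥ 1 − δ, and for every ((α^{tr}_1, …, α^{tr}_N), (α^{br}_1, …, α^{br}_M)) ∈ E there exist weights w_{ki} ∈ ℝ (k = 1,…,N, i = 1,…,M) such that for every u ∈ U and every y ∈ K₂: | F(u)(y) − ∑_{k=1}^N ∑_{i=1}^M w_{ki} · ϕ^{br}( α^{br}_i · (u(x_1), …, u(x_m)) ) · ϕ^{tr}(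 α^{tr}_k · y ) | < ε. -/

import Mathlib

open scoped BigOperators RealInnerProductSpace
open MeasureTheory

/-- A probability measure `p` on `ℝ^q` is `(ϕ, V)`-rich if there exists a bounded continuous
`g : ℝ^q → ℝ` such that (i) the span of `{x ↦ g(a x + b)}` is dense in `C(V)` (sup norm), and
(ii) each `x ↦ g(a x + b)` has a bounded measurable representation
`g(a x + b) = ∫ β(α) ϕ(α · x) dp(α)` on `V`. -/
def IsRich {q : ℕ} (ϕ : ℝ → ℝ) (V : Set (EuclideanSpace ℝ (Fin q)))
    (p : Measure (EuclideanSpace ℝ (Fin q))) : Prop :=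
  ∃ g : EuclideanSpace ℝ (Fin q) → ℝ,
    Continuous g ∧ (∃ Cg : ℝ, ∀ x, |g x| ≤ Cg) ∧
    (∀ f : EuclideanSpace ℝ (Fin q) → ℝ, ContinuousOn f V → ∀ ε : ℝ, 0 < ε →
      ∃ (N : ℕ) (w a : Fin N → ℝ) (b : Fin N → EuclideanSpace ℝ (Fin q)),
        ∀ x ∈ V, |f x - ∑ i, w i * g (a i • x + b i)| < ε) ∧
    (∀ (a : ℝ) (b : EuclideanSpace ℝ (Fin q)),
      ∃ β : EuclideanSpace ℝ (Fin q) → ℝ,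
        Measurable β ∧ (∃ Cβ : ℝ, ∀ α, |β α| ≤ Cβ) ∧
        ∀ x ∈ V, g (a • x + b) = ∫ α, β α * ϕ ⟪α, x⟫ ∂p)

lemma rn_lln {Ω E : Type*} [MeasurableSpace Ω] [NormedAddCommGroup E] [NormedSpace ℝ E]
    [CompleteSpace E] (p : Measure Ω) [IsProbabilityMeasure p] (ξ : Ω → E)
    (hξ : StronglyMeasurable ξ) (hint : Integrable ξ p) (ε δ : ℝ) (hε : 0 < ε) (hδ : 0 < δ) :
    ∃ (N : ℕ) (S : Set (Fin N → Ω)), MeasurableSet S ∧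
      ENNReal.ofReal (1 - δ) ≤ (Measure.pi fun _ : Fin N => p) S ∧
      ∀ α ∈ S, ‖(N : ℝ)⁻¹ • ∑ k, ξ (α k) - ∫ a, ξ a ∂p‖ < ε := by
  classical
  borelize E
  let P : Measure (ℕ → Ω) := Measure.infinitePi (fun _ => p)
  have hmp : ∀ i, MeasurePreserving (Function.eval i) P p := fun i =>
    measurePreserving_eval_infinitePi (fun _ : ℕ => p) i
  let Y : ℕ → (ℕ → Ω) → E := fun i ω => ξ (ω i)
  have hY : ∀ i, StronglyMeasurable (Y i) := fun i =>
    hξ.comp_measurable (measurable_pi_apply i)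
  have hind : ProbabilityTheory.iIndepFun Y P :=
    ProbabilityTheory.iIndepFun_infinitePi (P := fun _ : ℕ => p) (X := fun _ => ξ)
      (fun _ => hξ.measurable)
  have hid : ∀ i, ProbabilityTheory.IdentDistrib (Y i) (Y 0) P P := by
    intro i
    refine ⟨(hY i).measurable.aemeasurable, (hY 0).measurable.aemeasurable, ?_⟩
    have h : ∀ j, P.map (Y j) = p.map ξ := by
      intro j
      rw [← (hmp j).map_eq, Measure.map_map hξ.measurable (hmp j).measurable]
      rfl
    rw [h, h]
  have hI : ∫ ω, Y 0 ω ∂P = ∫ a, ξ a ∂p := by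
    rw [← (hmp 0).map_eq, integral_map (hmp 0).measurable.aemeasurable
      hξ.aestronglyMeasurable]
  have hint0 : Integrable (Y 0) P := (hmp 0).integrable_comp_of_integrable hint
  have key := ProbabilityTheory.strong_law_ae Y hint0 (fun i j hij => hind.indepFun hij) hid
  rw [hI] at key
  have hms : ∀ n : ℕ, StronglyMeasurable
      (fun ω : ℕ → Ω => (n : ℝ)⁻¹ • (∑ i ∈ Finset.range n, Y i ω)) := fun n =>
    (Finset.stronglyMeasurable_fun_sum _ (fun i _ => hY i)).const_smul _
  have hTM := tendstoInMeasure_of_tendsto_ae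
    (fun n => (hms n).aestronglyMeasurable (μ := P)) key
  rw [tendstoInMeasure_iff_norm] at hTM
  have h1 := (hTM ε hε).eventually (gt_mem_nhds (ENNReal.ofReal_pos.2 hδ))
  obtain ⟨N, hN⟩ := h1.exists
  let S : Set (Fin N → Ω) := {α | ‖(N : ℝ)⁻¹ • ∑ k, ξ (α k) - ∫ a, ξ a ∂p‖ < ε}
  have hS : MeasurableSet S := by
    have : StronglyMeasurable
      (fun α : Fin N → Ω => ‖(N : ℝ)⁻¹ • ∑ k, ξ (α k) - ∫ a, ξ a ∂p‖) :=
      (((Finset.stronglyMeasurable_fun_sum _ (fun i _ =>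
        hξ.comp_measurable (measurable_pi_apply i))).const_smul _).sub
        stronglyMeasurable_const).norm
    exact measurableSet_lt this.measurable measurable_const
  refine ⟨N, S, hS, ?_, fun α hα => hα⟩
  let r : (ℕ → Ω) → (Fin N → Ω) := fun ω k => ω k
  have hr : Measurable r := measurable_pi_lambda _ (fun k => measurable_pi_apply _)
  have hmap : P.map r = Measure.pi fun _ : Fin N => p := by
    have := Measure.map_infinitePi_infinitePi_of_inj (P := fun _ : ℕ => p)
      (f := fun k : Fin N => (k : ℕ)) Fin.val_injective
    rw [← Measure.infinitePi_eq_pi]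
    exact this
  rw [← hmap, Measure.map_apply hr hS]
  have hcompl : P (r ⁻¹' S)ᶜ ≤ ENNReal.ofReal δ := by
    refine le_trans (le_of_eq ?_) hN.le
    congr 1
    ext ω
    simp [S, r, Y, Finset.sum_range]
  rw [prob_compl_eq_one_sub (hr hS)] at hcompl
  rw [ENNReal.ofReal_sub _ hδ.le, ENNReal.ofReal_one]
  exact tsub_le_iff_tsub_le.1 hcompl

lemma rn_rich {q : ℕ} {ϕ : ℝ → ℝ} {V : Set (EuclideanSpace ℝ (Fin q))} (hV : IsCompact V)
    {p : Measure (EuclideanSpace ℝ (Fin q))} [IsProbabilityMeasure p]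
    (hϕ : Continuous ϕ) (hϕb : ∀ t, |ϕ t| ≤ 1) (hrich : IsRich ϕ V p)
    {ι : Type} [Fintype ι] (f : ι → C(V, ℝ)) (ε δ : ℝ) (hε : 0 < ε) (hδ : 0 < δ) :
    ∃ (N : ℕ) (S : Set (Fin N → EuclideanSpace ℝ (Fin q))), MeasurableSet S ∧
      ENNReal.ofReal (1 - δ) ≤ (Measure.pi fun _ : Fin N => p) S ∧
      ∀ α ∈ S, ∃ w : ι → Fin N → ℝ, ∀ l, ∀ x : V,
        |f l x - ∑ k, w l k * ϕ ⟪α k, (x : EuclideanSpace ℝ (Fin q))⟫| < ε := by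
  classical
  have : CompactSpace V := isCompact_iff_compactSpace.1 hV
  obtain ⟨g, -, -, hd, hrep⟩ := hrich
  -- one bounded density for every target function
  have hβ : ∀ l, ∃ β : EuclideanSpace ℝ (Fin q) → ℝ, Measurable β ∧
      (∃ C : ℝ, ∀ α, |β α| ≤ C) ∧
      ∀ x : V, |f l x - ∫ α, β α * ϕ ⟪α, (x : EuclideanSpace ℝ (Fin q))⟫ ∂p| < ε / 2 := by
    intro l
    have hc : ContinuousOn (fun x => if h : x ∈ V then f l ⟨x, h⟩ else 0) V := by
      rw [continuousOn_iff_continuous_domRestrict]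
      convert (f l).continuous using 1
      ext x
      simp
    obtain ⟨n, w, a, b, h⟩ := hd _ hc (ε / 2) (half_pos hε)
    choose β hβm hCb hβr using hrep
    choose C hC using hCb
    refine ⟨fun α => ∑ i, w i * β (a i) (b i) α, ?_, ⟨∑ i, |w i| * C (a i) (b i), ?_⟩, ?_⟩
    · exact Finset.measurable_sum _ (fun i _ => (hβm _ _).const_mul _)
    · intro α
      refine (Finset.abs_sum_le_sum_abs _ _).trans (Finset.sum_le_sum fun i _ => ?_)
      rw [abs_mul]
      exact mul_le_mul_of_nonneg_left (hC _ _ _) (abs_nonneg _)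
    · intro x
      have hx := h x x.2
      simp only [Subtype.coe_prop, dif_pos, Subtype.coe_eta] at hx
      have : ∫ α, (∑ i, w i * β (a i) (b i) α) * ϕ ⟪α, (x : EuclideanSpace ℝ (Fin q))⟫ ∂p
          = ∑ i, w i * g (a i • (x : EuclideanSpace ℝ (Fin q)) + b i) := by
        simp_rw [Finset.sum_mul, mul_assoc]
        rw [integral_finsetSum]
        · refine Finset.sum_congr rfl fun i _ => ?_
          rw [integral_const_mul, ← hβr _ _ _ x.2]
        · intro i _
          refine Integrable.const_mul ?_ _
          refine Integrable.of_bound (C := C (a i) (b i) * 1) ?_ ?_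
          · refine ((hβm _ _).mul ?_).aestronglyMeasurable
            exact hϕ.measurable.comp
              (Continuous.measurable (by fun_prop))
          · refine Filter.Eventually.of_forall fun α => ?_
            rw [Real.norm_eq_abs, abs_mul]
            exact mul_le_mul (hC _ _ _) (hϕb _) (abs_nonneg _)
              ((abs_nonneg _).trans (hC _ _ α))
      rw [this]
      exact hx
  choose β hβm hCb hβ using hβ
  choose C hC using hCb
  let Φ' : C(EuclideanSpace ℝ (Fin q) × V, ℝ) :=
    ⟨fun z => ϕ ⟪z.1, (z.2 : EuclideanSpace ℝ (Fin q))⟫, hϕ.comp (by fun_prop)⟩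
  let Φ : EuclideanSpace ℝ (Fin q) → C(V, ℝ) := fun α => Φ'.curry α
  have hΦc : Continuous Φ := Φ'.curry.continuous
  have hΦa : ∀ α (x : V), Φ α x = ϕ ⟪α, (x : EuclideanSpace ℝ (Fin q))⟫ := fun _ _ => rfl
  have hΦn : ∀ α, ‖Φ α‖ ≤ 1 := fun α =>
    (ContinuousMap.norm_le _ zero_le_one).2 fun x => hϕb _
  let ξ : EuclideanSpace ℝ (Fin q) → (ι → C(V, ℝ)) := fun α l => β l α • Φ α
  have hξl : ∀ l, StronglyMeasurable (fun α => ξ α l) := fun l =>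
    (hβm l).stronglyMeasurable.smul hΦc.stronglyMeasurable
  have hξ : StronglyMeasurable ξ := by
    have h0 : ξ = fun α => ∑ l, Pi.single (M := fun _ : ι => C(V, ℝ)) l (ξ α l) := by
      funext α
      exact (Finset.univ_sum_single (ξ α)).symm
    rw [h0]
    exact Finset.stronglyMeasurable_fun_sum _ fun l _ =>
      (continuous_single (A := fun _ : ι => C(V, ℝ)) l).comp_stronglyMeasurable (hξl l)
  have hξli : ∀ l, Integrable (fun α => ξ α l) p := by
    intro l
    refine Integrable.of_bound (C := C l * 1) (hξl l).aestronglyMeasurable ?_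
    refine Filter.Eventually.of_forall fun α => ?_
    change ‖β l α • Φ α‖ ≤ C l * 1
    rw [norm_smul]
    exact mul_le_mul (hC _ _) (hΦn _) (norm_nonneg _) ((abs_nonneg _).trans (hC l α))
  have hξi : Integrable ξ p := Integrable.of_eval hξli
  have hI : ∀ l (x : V), (∫ a, ξ a ∂p) l x
      = ∫ α, β l α * ϕ ⟪α, (x : EuclideanSpace ℝ (Fin q))⟫ ∂p := by
    intro l x
    let T : (ι → C(V, ℝ)) →L[ℝ] ℝ :=
      (ContinuousMap.evalCLM ℝ x).comp (ContinuousLinearMap.proj l)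
    exact (T.integral_comp_comm hξi).symm
  obtain ⟨N, S, hS, hP, h⟩ := rn_lln p ξ hξ hξi (ε / 2) δ (half_pos hε) hδ
  refine ⟨N, S, hS, hP, fun α hα => ⟨fun l k => (N : ℝ)⁻¹ * β l (α k), fun l x => ?_⟩⟩
  have h1 := h α hα
  have h2 : |((N : ℝ)⁻¹ • ∑ k, ξ (α k) - ∫ a, ξ a ∂p) l x| < ε / 2 :=
    lt_of_le_of_lt ((ContinuousMap.norm_coe_le_norm
      (((N : ℝ)⁻¹ • ∑ k, ξ (α k) - ∫ a, ξ a ∂p) l) x).trans (norm_le_pi_norm _ l)) h1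
  have h3 : ((N : ℝ)⁻¹ • ∑ k, ξ (α k) - ∫ a, ξ a ∂p) l x
      = (∑ k, (N : ℝ)⁻¹ * β l (α k) * ϕ ⟪α k, (x : EuclideanSpace ℝ (Fin q))⟫)
        - ∫ α, β l α * ϕ ⟪α, (x : EuclideanSpace ℝ (Fin q))⟫ ∂p := by
    rw [← hI]
    simp [ξ, hΦa, Finset.mul_sum, mul_assoc]
  rw [h3] at h2
  have h4 := hβ l x
  rw [abs_lt] at *
  constructor <;> linarith [h2.1, h2.2, h4.1, h4.2]

/-- Separated approximation, by Stone-Weierstrass. -/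
lemma rn_sep {T K L : Type*} [TopologicalSpace T] [CompactSpace T] [TopologicalSpace L]
    [CompactSpace L] [T2Space L] (e : T → K → ℝ) (he : ∀ k, Continuous fun t => e t k)
    (hsep : Function.Injective e) (G : C(T × L, ℝ)) (ε : ℝ) (hε : 0 < ε) :
    ∃ (S : Finset K) (ι : Type) (_ : Fintype ι) (A : ι → (K → ℝ) → ℝ) (h : ι → C(L, ℝ)),
      (∀ l, Continuous (A l)) ∧ (∀ l, DependsOn (A l) (S : Set K)) ∧
      ∀ t y, |G (t, y) - ∑ l, A l (e t) * h l y| < ε := by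
  classical
  let e₁ : K → C(T × L, ℝ) := fun k => ⟨fun z => e z.1 k, (he k).comp continuous_fst⟩
  let e₂ : C(L, ℝ) → C(T × L, ℝ) := fun h => ⟨fun z => h z.2, h.continuous.comp continuous_snd⟩
  let B : Subalgebra ℝ C(T × L, ℝ) := Algebra.adjoin ℝ (Set.range e₁ ∪ Set.range e₂)
  have hB : B.SeparatesPoints := by
    rintro ⟨t, y⟩ ⟨t', y'⟩ hne
    by_cases ht : t = t'
    · have hy : y ≠ y' := fun hy => hne (by rw [ht, hy])
      obtain ⟨h, hh⟩ : ∃ h : C(L, ℝ), h y ≠ h y' := by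
        obtain ⟨h, h0, h1, -⟩ := exists_continuous_zero_one_of_isClosed
          (isClosed_singleton (x := y)) (isClosed_singleton (x := y'))
          (by simpa using hy)
        refine ⟨h, ?_⟩
        rw [h0 rfl, h1 rfl]
        simp
      exact ⟨e₂ h, ⟨e₂ h, Algebra.subset_adjoin (Or.inr ⟨h, rfl⟩), rfl⟩, hh⟩
    · have : e t ≠ e t' := fun h => ht (hsep h)
      obtain ⟨k, hk⟩ := Function.ne_iff.1 this
      exact ⟨e₁ k, ⟨e₁ k, Algebra.subset_adjoin (Or.inl ⟨k, rfl⟩), rfl⟩, hk⟩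
  obtain ⟨⟨b, hb⟩, hbG⟩ :=
    ContinuousMap.exists_mem_subalgebra_near_continuousMap_of_separatesPoints B hB G ε hε
  have key : ∃ (S : Finset K) (ι : Type) (_ : Fintype ι) (A : ι → (K → ℝ) → ℝ) (h : ι → C(L, ℝ)),
      (∀ l, Continuous (A l)) ∧ (∀ l, DependsOn (A l) (S : Set K)) ∧
      ∀ t y, b (t, y) = ∑ l, A l (e t) * h l y := by
    clear hbG
    induction hb using Algebra.adjoin_induction with
    | mem x hx =>
      rcases hx with ⟨k, rfl⟩ | ⟨h, rfl⟩
      · refine ⟨{k}, Unit, inferInstance, fun _ v => v k, fun _ => 1, fun _ => by fun_prop, ?_, ?_⟩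
        · intro _ v w hvw
          exact hvw k (by simp)
        · intro t y
          simp [e₁]
      · refine ⟨∅, Unit, inferInstance, fun _ v => 1, fun _ => h, fun _ => by fun_prop, ?_, ?_⟩
        · intro _ v w hvw
          rfl
        · intro t y
          simp [e₂]
    | algebraMap r =>
      refine ⟨∅, Unit, inferInstance, fun _ v => r, fun _ => 1, fun _ => by fun_prop, ?_, ?_⟩
      · intro _ v w hvw
        rfl
      · intro t y
        simp
    | add x y _ _ ihx ihy =>
      obtain ⟨S, ι, _, A, h, hA, hd, hx⟩ := ihx
      obtain ⟨S', ι', _, A', h', hA', hd', hx'⟩ := ihy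
      refine ⟨S ∪ S', ι ⊕ ι', inferInstance, Sum.elim A A', Sum.elim h h', ?_, ?_, ?_⟩
      · rintro (l | l)
        · exact hA l
        · exact hA' l
      · rintro (l | l) v w hvw
        · exact hd l fun i hi => hvw i (by simp at hi ⊢; exact Or.inl hi)
        · exact hd' l fun i hi => hvw i (by simp at hi ⊢; exact Or.inr hi)
      · intro t y
        simp [hx, hx']
    | mul x y _ _ ihx ihy =>
      obtain ⟨S, ι, _, A, h, hA, hd, hx⟩ := ihx
      obtain ⟨S', ι', _, A', h', hA', hd', hx'⟩ := ihy
      refine ⟨S ∪ S', ι × ι', inferInstance, fun l v => A l.1 v * A' l.2 v,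
        fun l => h l.1 * h' l.2, ?_, ?_, ?_⟩
      · exact fun l => (hA _).mul (hA' _)
      · intro l v w hvw
        have h1 := hd l.1 fun i hi => hvw i (by simp at hi ⊢; exact Or.inl hi)
        have h2 := hd' l.2 fun i hi => hvw i (by simp at hi ⊢; exact Or.inr hi)
        simp only [h1, h2]
      · intro t y
        simp only [ContinuousMap.mul_apply, hx, hx', Finset.sum_mul_sum, Fintype.sum_prod_type]
        refine Finset.sum_congr rfl fun i _ => Finset.sum_congr rfl fun j _ => ?_
        ring
  obtain ⟨S, ι, hι, A, h, hA, hd, hx⟩ := key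
  refine ⟨S, ι, hι, A, h, hA, hd, fun t y => ?_⟩
  rw [← hx, abs_sub_comm]
  exact lt_of_le_of_lt (ContinuousMap.norm_coe_le_norm (b - G) (t, y)) hbG

theorem randonet_universal_approximation_of_operators
    {X : Type*} [NormedAddCommGroup X] [NormedSpace ℝ X] [CompleteSpace X]
    (d : ℕ)
    (K₁ : Set X) (hK₁ : IsCompact K₁)
    (K₂ : Set (EuclideanSpace ℝ (Fin d))) (hK₂ : IsCompact K₂)
    (U : Set C(K₁, ℝ)) (hU : IsCompact U)
    (F : U → C(K₂, ℝ)) (hF : Continuous F)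
    (ϕtr ϕbr : ℝ → ℝ)
    (hϕtrLip : ∃ L : NNReal, LipschitzWith L ϕtr) (hϕtrbdd : ∀ t : ℝ, |ϕtr t| ≤ 1)
    (hϕbrLip : ∃ L : NNReal, LipschitzWith L ϕbr) (hϕbrbdd : ∀ t : ℝ, |ϕbr t| ≤ 1)
    (ptr : Measure (EuclideanSpace ℝ (Fin d))) [IsProbabilityMeasure ptr]
    (hptr_rich : IsRich ϕtr K₂ ptr)
    (pbr : ∀ m : ℕ, Measure (EuclideanSpace ℝ (Fin m)))
    (hpbr : ∀ m, IsProbabilityMeasure (pbr m))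
    (hpbr_rich : ∀ (m : ℕ) (V : Set (EuclideanSpace ℝ (Fin m))), IsCompact V →
      IsRich ϕbr V (pbr m))
    (ε : ℝ) (hε : 0 < ε) (δ : ℝ) (hδ : δ ∈ Set.Ioo (0 : ℝ) 1) :
    ∃ (N M m : ℕ) (x : Fin m → K₁),
      ∃ E : Set ((Fin N → EuclideanSpace ℝ (Fin d)) × (Fin M → EuclideanSpace ℝ (Fin m))),
        MeasurableSet E ∧
        ENNReal.ofReal (1 - δ) ≤
          ((Measure.pi fun _ : Fin N => ptr).prod (Measure.pi fun _ : Fin M => pbr m)) E ∧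
        ∀ αs ∈ E, ∃ w : Fin N → Fin M → ℝ,
          ∀ u : U, ∀ y : K₂,
            |F u y - ∑ k, ∑ i, w k i *
                ϕbr ⟪αs.2 i, (WithLp.equiv 2 (Fin m → ℝ)).symm
                    (fun j => (u : C(K₁, ℝ)) (x j))⟫ *
                ϕtr ⟪αs.1 k, (y : EuclideanSpace ℝ (Fin d))⟫| < ε := by
  classical
  have : CompactSpace K₁ := isCompact_iff_compactSpace.1 hK₁
  have : CompactSpace K₂ := isCompact_iff_compactSpace.1 hK₂
  have : CompactSpace U := isCompact_iff_compactSpace.1 hU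
  let G : C(U × K₂, ℝ) := ⟨fun z => F z.1 z.2, by fun_prop⟩
  let e : U → K₁ → ℝ := fun u x => (u : C(K₁, ℝ)) x
  have hec : ∀ k, Continuous fun u => e u k := fun k => by
    simp only [e]
    fun_prop
  obtain ⟨S, ι, _, A, h, hA, hd, hG⟩ := rn_sep e hec
    (fun u v huv => Subtype.ext (ContinuousMap.ext fun x => congrFun huv x)) G (ε / 2)
    (half_pos hε)
  let x : Fin S.card → K₁ := fun j => (S.equivFin.symm j).1
  let ev : U → EuclideanSpace ℝ (Fin S.card) := fun u =>
    (WithLp.equiv 2 (Fin S.card → ℝ)).symm (fun j => (u : C(K₁, ℝ)) (x j))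
  have hev : Continuous ev :=
    (PiLp.continuous_toLp 2 _).comp (continuous_pi fun j => hec (x j))
  let V : Set (EuclideanSpace ℝ (Fin S.card)) := Set.range ev
  have hV : IsCompact V := isCompact_range hev
  have : CompactSpace V := isCompact_iff_compactSpace.1 hV
  let ext : EuclideanSpace ℝ (Fin S.card) → K₁ → ℝ := fun v k =>
    if hk : k ∈ S then v (S.equivFin ⟨k, hk⟩) else 0
  have hext : Continuous ext := by
    refine continuous_pi fun k => ?_
    by_cases hk : k ∈ S
    · simp only [ext, hk, dif_pos]
      fun_prop
    · simp only [ext, hk, dif_neg, not_false_eq_true]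
      fun_prop
  let A' : ι → C(V, ℝ) := fun l => ⟨fun v => A l (ext v), (hA l).comp (by fun_prop)⟩
  have hA' : ∀ l (u : U), A' l ⟨ev u, u, rfl⟩ = A l (e u) := by
    intro l u
    refine hd l fun k hk => ?_
    have hk' : k ∈ S := hk
    simp [ext, hk', ev, x, e]
  obtain ⟨C, hC0, hCA, hCh⟩ : ∃ C : ℝ, 0 ≤ C ∧ (∀ l, ‖A' l‖ ≤ C) ∧ ∀ l, ‖h l‖ ≤ C := by
    have h1 : ∀ l, ‖A' l‖ ≤ ∑ l, ‖A' l‖ := fun l =>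
      Finset.single_le_sum (f := fun l => ‖A' l‖) (fun _ _ => norm_nonneg _) (Finset.mem_univ l)
    have h2 : ∀ l, ‖h l‖ ≤ ∑ l, ‖h l‖ := fun l =>
      Finset.single_le_sum (f := fun l => ‖h l‖) (fun _ _ => norm_nonneg _) (Finset.mem_univ l)
    have h3 : 0 ≤ ∑ l, ‖A' l‖ := Finset.sum_nonneg fun _ _ => norm_nonneg _
    have h4 : 0 ≤ ∑ l, ‖h l‖ := Finset.sum_nonneg fun _ _ => norm_nonneg _
    exact ⟨∑ l, ‖A' l‖ + ∑ l, ‖h l‖, by positivity, fun l => by linarith [h1 l],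
      fun l => by linarith [h2 l]⟩
  let n : ℝ := (Fintype.card ι : ℝ)
  have hn : 0 ≤ n := Nat.cast_nonneg _
  let η : ℝ := min 1 (ε / 2 / ((n + 1) * (2 * C + 1)))
  have hη : 0 < η := lt_min one_pos (by positivity)
  have hη1 : η ≤ 1 := min_le_left _ _
  have hη2 : n * ((2 * C + 1) * η) ≤ ε / 2 := by
    have h1 : η ≤ ε / 2 / ((n + 1) * (2 * C + 1)) := min_le_right _ _
    rw [le_div_iff₀ (by positivity)] at h1
    have : 0 ≤ (2 * C + 1) * η := by positivity
    nlinarith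
  obtain ⟨Ltr, hLtr⟩ := hϕtrLip
  obtain ⟨Lbr, hLbr⟩ := hϕbrLip
  have := hpbr S.card
  obtain ⟨N, Et, hEt, hPt, hwt⟩ := rn_rich hK₂ hLtr.continuous hϕtrbdd hptr_rich h η (δ / 2) hη
    (half_pos hδ.1)
  obtain ⟨M, Eb, hEb, hPb, hwb⟩ := rn_rich hV hLbr.continuous hϕbrbdd
    (hpbr_rich S.card V hV) A' η (δ / 2) hη (half_pos hδ.1)
  refine ⟨N, M, S.card, x, Et ×ˢ Eb, hEt.prod hEb, ?_, ?_⟩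
  · rw [Measure.prod_prod]
    refine le_trans ?_ (mul_le_mul' hPt hPb)
    rw [← ENNReal.ofReal_mul (by linarith [hδ.2])]
    exact ENNReal.ofReal_le_ofReal (by nlinarith [sq_nonneg δ])
  · rintro ⟨αt, αb⟩ ⟨ht, hb⟩
    obtain ⟨wt, hwt⟩ := hwt αt ht
    obtain ⟨wb, hwb⟩ := hwb αb hb
    refine ⟨fun k i => ∑ l, wb l i * wt l k, fun u y => ?_⟩
    have hsum : (∑ k, ∑ i, (∑ l, wb l i * wt l k) * ϕbr ⟪αb i, ev u⟫ *
          ϕtr ⟪αt k, (y : EuclideanSpace ℝ (Fin d))⟫)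
        = ∑ l, (∑ i, wb l i * ϕbr ⟪αb i, ev u⟫) *
          ∑ k, wt l k * ϕtr ⟪αt k, (y : EuclideanSpace ℝ (Fin d))⟫ := by
      simp_rw [Finset.sum_mul_sum, Finset.sum_mul]
      rw [Finset.sum_comm' (t' := Finset.univ) (s' := fun _ => Finset.univ) (by simp)]
      rw [Finset.sum_congr rfl fun i _ => Finset.sum_comm]
      rw [Finset.sum_comm]
      refine Finset.sum_congr rfl fun l _ => Finset.sum_congr rfl fun i _ =>
        Finset.sum_congr rfl fun k _ => ?_
      ring
    change |G (u, y) - ∑ k, ∑ i, (∑ l, wb l i * wt l k) * ϕbr ⟪αb i, ev u⟫ *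
          ϕtr ⟪αt k, (y : EuclideanSpace ℝ (Fin d))⟫| < ε
    rw [hsum]
    have h1 := hG u y
    have h2 : |∑ l, A l (e u) * h l y - ∑ l, (∑ i, wb l i * ϕbr ⟪αb i, ev u⟫) *
          ∑ k, wt l k * ϕtr ⟪αt k, (y : EuclideanSpace ℝ (Fin d))⟫| ≤ ε / 2 := by
      refine le_trans ?_ hη2
      rw [← Finset.sum_sub_distrib]
      refine (Finset.abs_sum_le_sum_abs _ _).trans ?_
      refine (Finset.sum_le_card_nsmul Finset.univ _ ((2 * C + 1) * η) fun l _ => ?_).trans ?_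
      · have hb := hwb l ⟨ev u, u, rfl⟩
        have ht := hwt l y
        have hAn : |A' l ⟨ev u, u, rfl⟩| ≤ C :=
          (ContinuousMap.norm_coe_le_norm (A' l) _).trans (hCA l)
        have hhn : |h l y| ≤ C := (ContinuousMap.norm_coe_le_norm (h l) _).trans (hCh l)
        rw [hA'] at hb hAn
        simp only at hb
        generalize A l (e u) = a at *
        generalize h l y = c at *
        generalize ∑ i, wb l i * ϕbr ⟪αb i, ev u⟫ = a' at *
        generalize ∑ k, wt l k * ϕtr ⟪αt k, (y : EuclideanSpace ℝ (Fin d))⟫ = c' at *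
        have hc' : |c'| ≤ C + 1 := by
          have : c' = c - (c - c') := by ring
          rw [this]
          exact (abs_sub _ _).trans (by linarith)
        have : a * c - a' * c' = a * (c - c') + (a - a') * c' := by ring
        rw [this]
        refine (abs_add_le _ _).trans ?_
        rw [abs_mul, abs_mul]
        have h5 := mul_le_mul hAn ht.le (abs_nonneg _) hC0
        have h6 := mul_le_mul hb.le hc' (abs_nonneg _) hη.le
        linarith
      · simp [n]
    rw [abs_lt] at *
    rw [abs_le] at h2
    constructor <;> linarith [h2.1, h2.2, h1.1, h1.2]
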